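/- Let ℓ and p be distinct primes and t ∈ ℤ with reduction t̄ ∈ F_p. Let v_p be the maximum, over all a ∈ F_p, of the preperiod of a under the map f : F_p → F_p, f(x) = T_ℓ(x). If v_p > 0 and the preperiod of t̄ equals v_p, then for every n ≥ 1 the polynomial T_{ℓ^n}(X) − t̄ is irreducible in F_p[X], and consequently T_{ℓ^n}(X) − t is irreducible in ℤ[X]. -/

import Mathlib

open Polynomial Function

/-- The preperiod of `a` under `f` : the least `ρ ≥ 0` such that `f^[ρ] a` is a
periodic point of `f`. -/
noncomputable def preperiod {S : Type*} (f : S → S) (a : S) : ℕ :=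
  sInf {ρ : ℕ | f^[ρ] a ∈ Function.periodicPts f}

/-- If `v_ℓ(q ^ d - 1) = v_ℓ(q - 1) + v_ℓ(d)` and `v_ℓ(q - 1) ≤ a`, then the divisibility
`ℓ ^ (a + n) ∣ q ^ d - 1` forces `ℓ ^ n ∣ d`. -/
lemma pow_dvd_of_emultiplicity_pow_sub_one {ℓ d a n : ℕ} {q : ℤ}
    (hq : emultiplicity (ℓ : ℤ) (q ^ d - 1) =
      emultiplicity (ℓ : ℤ) (q - 1) + emultiplicity (ℓ : ℤ) (d : ℤ))
    (h : (ℓ : ℤ) ^ (a + n) ∣ q ^ d - 1) (h' : ¬ (ℓ : ℤ) ^ (a + 1) ∣ q - 1) :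
    ℓ ^ n ∣ d := by
  rw [pow_dvd_iff_le_emultiplicity, hq] at h
  rw [← emultiplicity_lt_iff_not_dvd] at h'
  rw [Int.natCast_emultiplicity] at h
  rw [pow_dvd_iff_le_emultiplicity]
  have h'' : emultiplicity (ℓ : ℤ) (q - 1) ≤ (a : ℕ∞) := by
    apply Order.le_of_lt_add_one
    exact_mod_cast h'
  have := h.trans (add_le_add_left h'' _)
  push_cast at this
  exact (ENat.add_le_add_iff_left (ENat.natCast_ne_top a)).1 this

lemma pow_dvd_exponent {ℓ p v n d : ℕ} (hℓ : ℓ.Prime)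
    (h0 : (ℓ : ℤ) ∣ p - 1 ∨ (ℓ : ℤ) ∣ p + 1)
    (h1 : ¬ (ℓ : ℤ) ^ (v + 1) ∣ p - 1) (h2 : ¬ (ℓ : ℤ) ^ (v + 1) ∣ p + 1)
    (h : (ℓ : ℤ) ^ (v + n) ∣ p ^ d - 1 ∨ (ℓ : ℤ) ^ (v + n) ∣ p ^ d + 1) :
    ℓ ^ n ∣ d := by
  have hℓ' : Prime (ℓ : ℤ) := Nat.prime_iff_prime_int.1 hℓ
  have e1 : (p : ℤ) ^ 2 - 1 = (p - 1) * (p + 1) := by ring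
  have ed : ((p : ℤ) ^ 2) ^ d - 1 = (p ^ d - 1) * (p ^ d + 1) := by
    rw [← pow_mul, mul_comm 2 d, pow_mul]; ring
  have hdvd : (ℓ : ℤ) ∣ p ^ 2 - 1 := by
    rw [e1]; exact h0.elim (fun h => h.mul_right _) (fun h => h.mul_left _)
  have hndvd : ¬ (ℓ : ℤ) ∣ p ^ 2 := fun hd => hℓ'.not_dvd_one (by simpa using dvd_sub hd hdvd)
  rcases eq_or_ne ℓ 2 with rfl | h2ℓ
  · have hodd : ∀ k, Odd ((p : ℤ) ^ k) := fun k => by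
      have : Odd (p : ℤ) := by
        rcases h0 with h0 | h0 <;> push_cast at h0
        · rw [← Int.not_even_iff_odd, even_iff_two_dvd]; omega
        · rw [← Int.not_even_iff_odd, even_iff_two_dvd]; omega
      exact this.pow
    have h4 : (4 : ℤ) ∣ p ^ 2 - 1 := by
      obtain ⟨k, hk⟩ := hodd 1
      rw [pow_one] at hk
      exact ⟨k * (k + 1), by rw [hk]; ring⟩
    apply pow_dvd_of_emultiplicity_pow_sub_one (a := v + 1) (q := (p : ℤ) ^ 2)
    · simpa using Int.two_pow_sub_pow' d h4 (by simpa using hndvd)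
    · rw [ed, show v + 1 + n = v + n + 1 by ring, pow_succ]
      obtain ⟨k, hk⟩ := hodd d
      rcases h with h | h
      · exact mul_dvd_mul h ⟨k + 1, by rw [hk]; push_cast; ring⟩
      · rw [mul_comm]
        exact mul_dvd_mul ⟨k, by rw [hk]; push_cast; ring⟩ h
    · rw [e1]
      intro hc
      obtain ⟨k, hk⟩ := hodd 1
      rw [pow_one] at hk
      push_cast at *
      have hc' : (2 : ℤ) ^ v ∣ k * (k + 1) := by
        have : (p - 1 : ℤ) * (p + 1) = 2 ^ 2 * (k * (k + 1)) := by rw [hk]; ring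
        rw [this, show v + 1 + 1 = 2 + v by ring, pow_add] at hc
        exact Int.dvd_of_mul_dvd_mul_left (by norm_num) hc
      rcases Int.even_or_odd k with hk' | hk'
      · have : ¬ (2 : ℤ) ∣ k + 1 := by rw [even_iff_two_dvd] at hk'; omega
        have := Int.prime_two.pow_dvd_of_dvd_mul_right v this hc'
        exact h1 (by rw [hk, pow_succ]; simpa [mul_comm] using mul_dvd_mul_left 2 this)
      · have : ¬ (2 : ℤ) ∣ k := by rw [← even_iff_two_dvd]; simpa using hk'
        have := Int.prime_two.pow_dvd_of_dvd_mul_left v this hc'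
        refine h2 ?_
        rw [hk, pow_succ, show 2 * k + 1 + 1 = (k + 1) * 2 by ring]
        exact mul_dvd_mul_right this 2
  · apply pow_dvd_of_emultiplicity_pow_sub_one (a := v) (q := (p : ℤ) ^ 2)
    · simpa [Int.natCast_emultiplicity] using Int.emultiplicity_pow_sub_pow hℓ (hℓ.odd_of_ne_two h2ℓ)
        (y := 1) hdvd hndvd d
    · rw [ed]; exact h.elim (fun h => h.mul_right _) (fun h => h.mul_left _)
    · rw [e1]
      intro hc
      by_cases hd : (ℓ : ℤ) ∣ p - 1
      · refine h1 (hℓ'.pow_dvd_of_dvd_mul_right _ (fun hd' => ?_) hc)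
        have := dvd_sub hd' hd
        rw [show (p : ℤ) + 1 - (p - 1) = (2 : ℕ) by push_cast; ring, Int.natCast_dvd_natCast] at this
        exact h2ℓ ((Nat.prime_dvd_prime_iff_eq hℓ Nat.prime_two).1 this)
      · exact h2 (hℓ'.pow_dvd_of_dvd_mul_left _ hd hc)

lemma add_inv_inj_iff {K : Type*} [Field K] {x y : K} (hx : x ≠ 0) (hy : y ≠ 0) :
    x + x⁻¹ = y + y⁻¹ ↔ x = y ∨ x = y⁻¹ := by
  constructor
  · intro h
    have : (x - y) * (x - y⁻¹) = 0 := by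
      field_simp at h ⊢
      linear_combination h
    simpa [sub_eq_zero] using this
  · rintro (rfl | rfl)
    · rfl
    · rw [inv_inv, add_comm]

lemma exists_add_inv_eq {K : Type*} [Field K] [IsAlgClosed K] (a : K) :
    ∃ x : K, x ≠ 0 ∧ x + x⁻¹ = a := by
  obtain ⟨x, hx⟩ := IsAlgClosed.exists_root (X ^ 2 - C a * X + 1 : K[X])
    (by rw [show (X ^ 2 - C a * X + 1 : K[X]) = C 1 * X ^ 2 + C (-a) * X + C 1 by simp; ring,
          degree_quadratic one_ne_zero]; decide)
  simp only [IsRoot, eval_add, eval_sub, eval_pow, eval_X, eval_mul, eval_C, eval_one] at hx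
  have hx0 : x ≠ 0 := by rintro rfl; simp at hx
  refine ⟨x, hx0, ?_⟩
  field_simp
  linear_combination hx

lemma add_inv_pow_eq_self_iff {K : Type*} [Field K] {x : K} (hx : x ≠ 0) (m : ℕ) :
    x ^ m + (x ^ m)⁻¹ = x + x⁻¹ ↔ (orderOf x : ℤ) ∣ m - 1 ∨ (orderOf x : ℤ) ∣ m + 1 := by
  rw [add_inv_inj_iff (pow_ne_zero _ hx) hx]
  obtain ⟨u, rfl⟩ : ∃ u : Kˣ, (u : K) = x := ⟨Units.mk0 x hx, rfl⟩
  rw [orderOf_units, orderOf_dvd_iff_zpow_eq_one, orderOf_dvd_iff_zpow_eq_one, zpow_sub, zpow_add,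
    zpow_one, zpow_natCast, mul_inv_eq_one, mul_eq_one_iff_eq_inv, Units.ext_iff, Units.ext_iff]
  simp

lemma add_inv_frobenius_eq_self_iff {K : Type*} [Field K] (p : ℕ) [Fact p.Prime] [CharP K p]
    {x : K} (hx : x ≠ 0) (d : ℕ) : (x + x⁻¹) ^ p ^ d = x + x⁻¹ ↔
      (orderOf x : ℤ) ∣ p ^ d - 1 ∨ (orderOf x : ℤ) ∣ p ^ d + 1 := by
  rw [add_pow_char_pow, inv_pow, add_inv_pow_eq_self_iff hx]
  push_cast
  rfl

lemma pow_dvd_orderOf_of_pow {G : Type*} [Monoid G] {ℓ k n : ℕ} (hℓ : ℓ.Prime) (hk : 0 < k) {y : G}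
    (h : ℓ ^ k ∣ orderOf (y ^ ℓ ^ n)) : ℓ ^ (k + n) ∣ orderOf y := by
  induction n generalizing y with
  | zero => simpa using h
  | succ n ih =>
    rw [pow_succ', pow_mul] at h
    have h1 := ih h
    have hd : ℓ ∣ orderOf y := by
      by_contra hd
      rw [Nat.Coprime.orderOf_pow ((Nat.Prime.coprime_iff_not_dvd hℓ).2 hd).symm] at h1
      exact hd ((dvd_pow_self _ (by omega)).trans h1)
    rw [orderOf_pow_of_dvd hℓ.ne_zero hd] at h1
    rw [← add_assoc, pow_succ']
    exact (Nat.dvd_div_iff_mul_dvd hd).1 h1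

lemma dickson_one_one_eval_add_inv' {K : Type*} [Field K] {x : K} (hx : x ≠ 0) (n : ℕ) :
    (dickson 1 (1 : K) n).eval (x + x⁻¹) = x ^ n + (x ^ n)⁻¹ := by
  rw [dickson_one_one_eval_add_inv _ _ (mul_inv_cancel₀ hx), inv_pow]

lemma iterate_dickson_one_one_eval {R : Type*} [CommRing R] (ℓ k : ℕ) :
    (fun x : R => (dickson 1 (1 : R) ℓ).eval x)^[k] =
      fun x => (dickson 1 (1 : R) (ℓ ^ k)).eval x := by
  induction k with
  | zero => ext; simp
  | succ k ih => ext x; rw [iterate_succ_apply', ih, pow_succ', dickson_one_one_mul, eval_comp]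

lemma dickson_one_one_monic_natDegree {R : Type*} [CommRing R] [Nontrivial R] (n : ℕ) :
    (dickson 1 (1 : R) (n + 1)).Monic ∧ (dickson 1 (1 : R) (n + 1)).natDegree = n + 1 := by
  induction n using Nat.strong_induction_on with
  | _ n ih =>
    match n with
    | 0 => simp [monic_X]
    | n + 1 =>
      have h1 := ih n (by omega)
      have hX : (X * dickson 1 (1 : R) (n + 1)).Monic := monic_X.mul h1.1
      have hd : (X * dickson 1 (1 : R) (n + 1)).natDegree = n + 2 := by
        rw [monic_X.natDegree_mul h1.1, h1.2, natDegree_X]; ring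
      have hlt : (C 1 * dickson 1 (1 : R) n).degree < (X * dickson 1 (1 : R) (n + 1)).degree := by
        rw [degree_eq_natDegree hX.ne_zero, hd, C_1, one_mul]
        refine degree_le_natDegree.trans_lt ?_
        rw [Nat.cast_lt]
        match n with
        | 0 =>
          rw [dickson_zero, show (3 - ((1 : ℕ) : R[X])) = C 2 by rw [C_ofNat]; push_cast; ring]
          simp
        | n + 1 => rw [(ih n (by omega)).2]; omega
      rw [dickson_add_two]
      refine ⟨hX.sub_of_left hlt, ?_⟩
      rw [natDegree_eq_of_degree_eq (degree_sub_eq_left_of_degree_lt hlt), hd]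

lemma algebraMap_iterate_dickson {k K : Type*} [CommRing k] [Field K] [Algebra k K] {a : k} {x : K}
    (hx : x ≠ 0) (hax : x + x⁻¹ = algebraMap k K a) (ℓ n : ℕ) :
    algebraMap k K ((fun y : k => (dickson 1 (1 : k) ℓ).eval y)^[n] a) =
      x ^ ℓ ^ n + (x ^ ℓ ^ n)⁻¹ := by
  rw [iterate_dickson_one_one_eval, ← dickson_one_one_eval_add_inv' hx, hax,
    ← map_one (algebraMap k K), ← map_dickson, eval_map_algebraMap, aeval_algebraMap_apply]
  rfl

lemma mem_periodicPts_dickson_iff {k K : Type*} [Field k] [Field K] [Algebra k K] {a : k} {x : K}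
    (hx : orderOf x ≠ 0) (hax : x + x⁻¹ = algebraMap k K a) {ℓ : ℕ} (hℓ : ℓ.Prime) :
    a ∈ periodicPts (fun y : k => (dickson 1 (1 : k) ℓ).eval y) ↔ ¬ ℓ ∣ orderOf x := by
  have hx0 : x ≠ 0 := by
    rintro rfl
    exact hx (by simp)
  have key (n : ℕ) : IsPeriodicPt (fun y : k => (dickson 1 (1 : k) ℓ).eval y) n a ↔
      (orderOf x : ℤ) ∣ (ℓ ^ n : ℕ) - 1 ∨ (orderOf x : ℤ) ∣ (ℓ ^ n : ℕ) + 1 := by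
    rw [← add_inv_pow_eq_self_iff hx0, ← algebraMap_iterate_dickson hx0 hax, hax,
      (algebraMap k K).injective.eq_iff, IsPeriodicPt, IsFixedPt]
  constructor
  · rintro ⟨n, hn, h⟩ hd
    have hd' : (ℓ : ℤ) ∣ orderOf x := Int.natCast_dvd_natCast.2 hd
    have hn' : (ℓ : ℤ) ∣ (ℓ ^ n : ℕ) := Int.natCast_dvd_natCast.2 (dvd_pow_self _ hn.ne')
    refine (Nat.prime_iff_prime_int.1 hℓ).not_dvd_one ?_
    rcases (key n).1 h with h | h
    · simpa using dvd_sub hn' (hd'.trans h)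
    · simpa using dvd_sub (hd'.trans h) hn'
  · intro hd
    refine ⟨(orderOf x).totient, Nat.totient_pos.2 (Nat.pos_of_ne_zero hx), (key _).2 (Or.inl ?_)⟩
    have := Nat.ModEq.pow_totient ((Nat.Prime.coprime_iff_not_dvd hℓ).2 hd)
    simpa using (Nat.modEq_iff_dvd.1 this.symm)

/-- If `a = x + x⁻¹` with `x` of finite order, then the preperiod of `a` under the Dickson
polynomial of prime degree `ℓ` is the `ℓ`-adic valuation of the order of `x`. -/
lemma pow_dvd_orderOf_iff_le_preperiod {k K : Type*} [Field k] [Field K] [Algebra k K] {a : k}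
    {x : K} (hx : orderOf x ≠ 0) (hax : x + x⁻¹ = algebraMap k K a) {ℓ : ℕ} (hℓ : ℓ.Prime) (m : ℕ) :
    ℓ ^ m ∣ orderOf x ↔ m ≤ preperiod (fun y : k => (dickson 1 (1 : k) ℓ).eval y) a := by
  have hx0 : x ≠ 0 := by
    rintro rfl
    exact hx (by simp)
  have hmem (ρ : ℕ) : (fun y : k => (dickson 1 (1 : k) ℓ).eval y)^[ρ] a ∈
      periodicPts (fun y : k => (dickson 1 (1 : k) ℓ).eval y) ↔ ¬ ℓ ∣ orderOf (x ^ ℓ ^ ρ) := by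
    refine mem_periodicPts_dickson_iff ?_ (algebraMap_iterate_dickson hx0 hax ℓ ρ).symm hℓ
    exact fun h => hx (orderOf_eq_zero_iff.2 fun hf => orderOf_eq_zero_iff.1 h hf.pow)
  obtain ⟨w, r, hr, hw⟩ := Nat.exists_eq_pow_mul_and_not_dvd hx ℓ hℓ.ne_one
  have hw' : preperiod (fun y : k => (dickson 1 (1 : k) ℓ).eval y) a = w := by
    have hset : {ρ : ℕ | (fun y : k => (dickson 1 (1 : k) ℓ).eval y)^[ρ] a ∈
        periodicPts (fun y : k => (dickson 1 (1 : k) ℓ).eval y)} = Set.Ici w := by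
      ext ρ
      rw [Set.mem_ofPred_eq, hmem, Set.mem_Ici]
      constructor
      · intro h
        have h1 : orderOf x ∣ ℓ ^ ρ * orderOf (x ^ ℓ ^ ρ) :=
          orderOf_dvd_of_pow_eq_one (by rw [pow_mul, pow_orderOf_eq_one])
        have h2 : ℓ ^ w ∣ ℓ ^ ρ := (Nat.Coprime.pow_left w
          ((Nat.Prime.coprime_iff_not_dvd hℓ).2 h)).dvd_of_dvd_mul_right
            ((Dvd.intro _ hw.symm).trans h1)
        exact (Nat.pow_dvd_pow_iff_le_right hℓ.one_lt).1 h2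
      · intro h hd
        obtain ⟨c, rfl⟩ := Nat.exists_eq_add_of_le h
        refine hr (hd.trans (orderOf_dvd_of_pow_eq_one ?_))
        rw [← pow_mul, pow_add, mul_right_comm, ← hw, pow_mul, pow_orderOf_eq_one, one_pow]
    rw [preperiod, hset, csInf_Ici]
  rw [hw', hw]
  constructor
  · intro h
    exact (Nat.pow_dvd_pow_iff_le_right hℓ.one_lt).1 ((Nat.Coprime.pow_left m
      ((Nat.Prime.coprime_iff_not_dvd hℓ).2 hr)).dvd_of_dvd_mul_right h)
  · exact fun h => (pow_dvd_pow _ h).mul_right _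

lemma dickson_sub_C_monic_natDegree {R : Type*} [CommRing R] [Nontrivial R] {n : ℕ} (hn : 0 < n)
    (t : R) : (dickson 1 (1 : R) n - C t).Monic ∧ (dickson 1 (1 : R) n - C t).natDegree = n := by
  obtain ⟨m, rfl⟩ := Nat.exists_eq_succ_of_ne_zero hn.ne'
  obtain ⟨h1, h2⟩ := dickson_one_one_monic_natDegree (R := R) m
  refine ⟨h1.sub_of_left ?_, by rw [natDegree_sub_C, h2]⟩
  refine degree_C_le.trans_lt ?_
  rw [degree_eq_natDegree h1.ne_zero, h2]
  exact_mod_cast hn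

lemma pow_card_pow_natDegree_minpoly {p : ℕ} [Fact p.Prime] {K : Type*} [Field K]
    [Algebra (ZMod p) K] {α : K} (hα : IsIntegral (ZMod p) α) :
    α ^ p ^ (minpoly (ZMod p) α).natDegree = α := by
  have h := ((minpoly.irreducible hα).natDegree_dvd_iff_dvd_X_pow_card_pow_sub_X).1 dvd_rfl
  have h2 := aeval_eq_zero_of_dvd_aeval_eq_zero h (minpoly.aeval _ α)
  simpa [sub_eq_zero] using h2

theorem irreducible_dickson_sub_C {ℓ p : ℕ} (hℓ : ℓ.Prime) [hp : Fact p.Prime] (hℓp : ℓ ≠ p)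
    {t : ZMod p} {v : ℕ}
    (hle : ∀ a : ZMod p,
      preperiod (fun x : ZMod p => (dickson 1 (1 : ZMod p) ℓ).eval x) a ≤ v)
    (hv : 0 < v)
    (htv : preperiod (fun x : ZMod p => (dickson 1 (1 : ZMod p) ℓ).eval x) t = v) (n : ℕ) :
    Irreducible (dickson 1 (1 : ZMod p) (ℓ ^ n) - C t) := by
  let K := AlgebraicClosure (ZMod p)
  have : CharP K p := charP_of_injective_algebraMap (algebraMap (ZMod p) K).injective p
  obtain ⟨hmonic, hdeg⟩ := dickson_sub_C_monic_natDegree (pow_pos hℓ.pos n) t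
  obtain ⟨α, hα⟩ := IsAlgClosed.exists_aeval_eq_zero K (dickson 1 (1 : ZMod p) (ℓ ^ n) - C t)
    (by rw [degree_eq_natDegree hmonic.ne_zero, hdeg]; exact_mod_cast (pow_pos hℓ.pos n).ne')
  obtain ⟨y, hy0, hy⟩ := exists_add_inv_eq α
  have hx0 := pow_ne_zero (ℓ ^ n) hy0
  have hx : y ^ ℓ ^ n + (y ^ ℓ ^ n)⁻¹ = algebraMap (ZMod p) K t := by
    rw [← dickson_one_one_eval_add_inv' hy0, hy, ← map_one (algebraMap (ZMod p) K), ← map_dickson,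
      eval_map_algebraMap, ← sub_eq_zero, ← hα]
    simp
  have hxp := (add_inv_frobenius_eq_self_iff p hx0 1).1
    (by rw [hx, ← map_pow, ZMod.pow_card_pow])
  rw [pow_one] at hxp
  have hxfin : orderOf (y ^ ℓ ^ n) ≠ 0 := by
    intro h0
    have := hp.out.one_lt
    rw [h0] at hxp
    simp only [Nat.cast_zero, zero_dvd_iff] at hxp
    omega
  have hvx : ℓ ^ v ∣ orderOf (y ^ ℓ ^ n) :=
    (pow_dvd_orderOf_iff_le_preperiod hxfin hx hℓ v).2 htv.ge
  have hvy := pow_dvd_orderOf_of_pow hℓ hv hvx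
  have hmax : ¬ ((ℓ : ℤ) ^ (v + 1) ∣ p - 1 ∨ (ℓ : ℤ) ^ (v + 1) ∣ p + 1) := by
    intro h
    have : NeZero (ℓ : K) := ⟨fun h0 => hℓp
      ((Nat.prime_dvd_prime_iff_eq hp.out hℓ).1 ((CharP.cast_eq_zero_iff K p ℓ).1 h0)).symm⟩
    obtain ⟨ζ, hζ⟩ := HasEnoughRootsOfUnity.exists_primitiveRoot K (ℓ ^ (v + 1))
    have hord := hζ.eq_orderOf
    have hne := (pow_pos hℓ.pos (v + 1)).ne'
    have hfix := (add_inv_frobenius_eq_self_iff p (hζ.ne_zero hne) 1).2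
      (by rw [← hord, pow_one]; exact_mod_cast h)
    rw [pow_one, ← Subfield.mem_bot_iff_pow_eq_self, ← ZMod.fieldRange_castHom_eq_bot p] at hfix
    obtain ⟨a, ha⟩ := hfix
    have ha' : ζ + ζ⁻¹ = algebraMap (ZMod p) K a := by
      rw [← ha]
      exact congrArg (fun f : ZMod p →+* K => f a) (Subsingleton.elim _ _)
    have := ((pow_dvd_orderOf_iff_le_preperiod (hord ▸ hne) ha' hℓ (v + 1)).1
      hord.dvd).trans (hle a)
    omega
  have hint : IsIntegral (ZMod p) α := Algebra.IsIntegral.isIntegral α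
  have hαfix := pow_card_pow_natDegree_minpoly hint
  have hdiv : ℓ ^ n ∣ (minpoly (ZMod p) α).natDegree := by
    rw [← hy] at hαfix ⊢
    have hvy' : (ℓ : ℤ) ^ (v + n) ∣ orderOf y := by exact_mod_cast hvy
    have hvx' : (ℓ : ℤ) ∣ orderOf (y ^ ℓ ^ n) :=
      Int.natCast_dvd_natCast.2 ((dvd_pow_self ℓ hv.ne').trans hvx)
    exact pow_dvd_exponent hℓ (hxp.imp hvx'.trans hvx'.trans) (fun h => hmax (Or.inl h))
      (fun h => hmax (Or.inr h))
      (((add_inv_frobenius_eq_self_iff p hy0 _).1 hαfix).imp hvy'.trans hvy'.trans)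
  have heq := eq_of_monic_of_dvd_of_natDegree_le (minpoly.monic hint) hmonic
    (minpoly.dvd _ _ hα) (by rw [hdeg]; exact Nat.le_of_dvd (minpoly.natDegree_pos hint) hdiv)
  rw [heq]
  exact minpoly.irreducible hint

/-- Let ℓ ≠ p be primes, t ∈ ℤ with reduction t̄ ∈ F_p, and v_p the
maximum preperiod of elements of F_p under x ↦ T_ℓ(x).  If v_p > 0 and the preperiod
of t̄ equals v_p, then for every n ≥ 1 the polynomial T_{ℓ^n}(X) − t̄ is irreducible in
F_p[X], hence T_{ℓ^n}(X) − t is irreducible in ℤ[X]. -/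
theorem chebyshev_iterates_irreducible
    (ℓ p : ℕ) (hℓ : ℓ.Prime) [hp : Fact p.Prime] (hℓp : ℓ ≠ p)
    (t : ℤ) (tbar : ZMod p) (ht : tbar = (t : ZMod p))
    (vp : ℕ)
    (hvp : IsGreatest
      (Set.range fun a : ZMod p =>
        preperiod (fun x : ZMod p => (dickson 1 (1 : ZMod p) ℓ).eval x) a) vp)
    (hvppos : 0 < vp)
    (htv : preperiod (fun x : ZMod p => (dickson 1 (1 : ZMod p) ℓ).eval x) tbar = vp) :
    ∀ n : ℕ, 1 ≤ n →
      Irreducible (dickson 1 (1 : ZMod p) (ℓ ^ n) - C tbar) ∧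
      Irreducible (dickson 1 (1 : ℤ) (ℓ ^ n) - C t) := by
  subst ht
  intro n _
  have h := irreducible_dickson_sub_C hℓ hℓp (fun a => hvp.2 ⟨a, rfl⟩) hvppos htv n
  refine ⟨h, (dickson_sub_C_monic_natDegree (pow_pos hℓ.pos n) t).1.irreducible_of_irreducible_map
    (Int.castRingHom (ZMod p)) _ ?_⟩
  simpa [map_dickson] using h
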